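/- Let f ∈ L¹(ℍⁿ), z ∈ ℂⁿ and τ ≥ 0. If (λ_j) is a sequence of nonzero real numbers with λ_j → 0 and (k_j) is a sequence in ℕ with (2k_j+n)|λ_j| → τ, then (k_j!(n−1)!/(k_j+n−1)!) · f^{−λ_j} ∗_{−λ_j} φ_{k_j,λ_j}(z) converges, as j → ∞, to (n−1)! 2^{n−1} ∫_{ℂⁿ} f⁰(z−w) J_{n−1}(√τ·|w|)/(√τ·|w|)^{n−1} dw. -/

import Mathlib

open MeasureTheory Complex Real Filter

noncomputable section

/-- ℂⁿ with its Euclidean (Hilbert space) structure. -/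
abbrev Cn (n : ℕ) := EuclideanSpace ℂ (Fin n)

instance (n : ℕ) : MeasurableSpace (Cn n) := borel _
instance (n : ℕ) : BorelSpace (Cn n) := ⟨rfl⟩
instance (n : ℕ) : InnerProductSpace ℝ (Cn n) := InnerProductSpace.rclikeToReal ℂ (Cn n)

/-- The Heisenberg group ℍⁿ = ℂⁿ × ℝ (as a measure space with Lebesgue/Haar measure). -/
abbrev Hn (n : ℕ) := Cn n × ℝ

/-- Im (z · w̄) = Im (∑ⱼ zⱼ conj wⱼ). -/
def imZW {n : ℕ} (z w : Cn n) : ℝ := (∑ j, z j * (starRingEnd ℂ) (w j)).im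

/-- The λ-twisted convolution F ∗_λ G (z) = ∫ F(z−w) G(w) e^{(i/2)λ Im(z·w̄)} dw. -/
def twConv (n : ℕ) (lam : ℝ) (F G : Cn n → ℂ) (z : Cn n) : ℂ :=
  ∫ w : Cn n, F (z - w) * G w * Complex.exp
    (Complex.I / 2 * (lam : ℂ) * ((imZW z w : ℝ) : ℂ))

/-- The inverse Fourier transform in the central variable, f^λ(z) = ∫ e^{iλt} f(z,t) dt. -/
def fLam (n : ℕ) (f : Hn n → ℂ) (lam : ℝ) (z : Cn n) : ℂ :=
  ∫ t : ℝ, Complex.exp (Complex.I * (lam : ℂ) * (t : ℂ)) * f (z, t)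

/-- The Laguerre polynomial of type m−1:
L_k^{m−1}(t) = ∑_{j=0}^k binom(k+m−1, k−j) (−t)^j / j!. -/
def lagPoly (m k : ℕ) (t : ℝ) : ℝ :=
  ∑ j ∈ Finset.range (k + 1), ((k + m - 1).choose (k - j) : ℝ) * (-t) ^ j / (Nat.factorial j)

/-- The Laguerre function φ_{k,λ}^{m−1}(z) = L_k^{m−1}(|λ||z|²/2) e^{−|λ||z|²/4} on ℂ^m. -/
def lagFun (m k : ℕ) (lam : ℝ) (z : Cn m) : ℝ :=
  lagPoly m k (|lam| * ‖z‖ ^ 2 / 2) * Real.exp (-(|lam| * ‖z‖ ^ 2 / 4))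

/-- The Strichartz Fourier transform f̂(a,z) = f^{−λ} ∗_{−λ} φ_{k,λ}(z)
at the point a = (λ, (2k+n)|λ|) of the ray R_k. -/
def stri (n : ℕ) (f : Hn n → ℂ) (k : ℕ) (lam : ℝ) (z : Cn n) : ℂ :=
  twConv n (-lam) (fLam n f (-lam)) (fun w => ((lagFun n k lam w : ℝ) : ℂ)) z

/-- The normalizing constant k!(n−1)!/(k+n−1)!. -/
def normC (n k : ℕ) : ℝ :=
  (Nat.factorial k * Nat.factorial (n - 1) : ℝ) / (Nat.factorial (k + n - 1))

/-- The Bessel kernel J_{n−1}(s)/s^{n−1}, extended by its limiting value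
1/(2^{n−1}(n−1)!) at s = 0, given by its power series. -/
def besselKer (n : ℕ) (s : ℝ) : ℝ :=
  ∑' m : ℕ, (-1 : ℝ) ^ m / (Nat.factorial m * Nat.factorial (m + n - 1)) *
    s ^ (2 * m) / 2 ^ (2 * m + n - 1)

/-- The Strichartz Fourier transform f̂((0,τ),z) on the limiting ray R_∞. -/
def striLim (n : ℕ) (f : Hn n → ℂ) (z : Cn n) (τ : ℝ) : ℂ :=
  ((Nat.factorial (n - 1) * 2 ^ (n - 1) : ℝ) : ℂ) *
    ∫ w : Cn n, fLam n f 0 (z - w) * ((besselKer n (Real.sqrt τ * ‖w‖) : ℝ) : ℂ)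

/-- The Heisenberg fan Ω ⊆ ℝ²: union of the rays R_k, k ∈ ℕ, and the limiting ray R_∞. -/
def fan (n : ℕ) : Set (ℝ × ℝ) :=
  {a | (∃ k : ℕ, a.1 ≠ 0 ∧ a.2 = (2 * k + n) * |a.1|) ∨ (a.1 = 0 ∧ 0 ≤ a.2)}

open scoped Classical in
/-- The index k of the ray R_k through a point of the fan (junk value otherwise). -/
def fanK (n : ℕ) (a : ℝ × ℝ) : ℕ :=
  if h : ∃ k : ℕ, a.2 = (2 * k + n) * |a.1| then h.choose else 0

/-- The normalized Strichartz Fourier transform f̃(a,z), as a function of a ∈ Ω. -/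
def striNorm (n : ℕ) (f : Hn n → ℂ) (z : Cn n) (a : ℝ × ℝ) : ℂ :=
  if a.1 = 0 then striLim n f z a.2
  else ((normC n (fanK n a) : ℝ) : ℂ) * stri n f (fanK n a) a.1 z

/-- The Plancherel measure ν on the Heisenberg fan:
∫ φ dν = (2π)^{−2n−1} ∫_ℝ (∑_k φ(λ,(2k+n)|λ|)) |λ|^{2n} dλ. -/
def fanMeasure (n : ℕ) : Measure (ℝ × ℝ) :=
  (ENNReal.ofReal ((2 * π) ^ (2 * n + 1)))⁻¹ •
    Measure.sum (fun k : ℕ =>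
      Measure.map (fun lam : ℝ => (lam, (2 * k + n) * |lam|))
        (volume.withDensity fun lam => ENNReal.ofReal (|lam| ^ (2 * n))))

/-- A function on ℍⁿ is radial if it is invariant under the action of the unitary group U(n). -/
def IsRadial (n : ℕ) (g : Hn n → ℂ) : Prop :=
  ∀ (U : Cn n ≃ₗᵢ[ℂ] Cn n) (x : Hn n), g (U x.1, x.2) = g x

/-- The k-th Laguerre coefficient R_k(λ, f) = (k!(n−1)!/(k+n−1)!) ∫ f^λ(w) φ_{k,λ}(w) dw. -/
def lagCoef (n : ℕ) (k : ℕ) (lam : ℝ) (f : Hn n → ℂ) : ℂ :=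
  ((normC n k : ℝ) : ℂ) * ∫ w : Cn n, fLam n f lam w * ((lagFun n k lam w : ℝ) : ℂ)

/-- The Gelfand (spherical Fourier) transform of a radial function on ℍ^m, evaluated at
(λ, (2j+m)|λ|). -/
def gelfand (m : ℕ) (h : Hn m → ℂ) (lam : ℝ) (j : ℕ) : ℂ :=
  ((normC m j : ℝ) : ℂ) *
    ∫ x : Hn m, h x * Complex.exp (Complex.I * (lam : ℂ) * (x.2 : ℂ)) *
      ((lagFun m j lam x.1 : ℝ) : ℂ)

/-- The group convolution on ℍⁿ: f∗g(x) = ∫ f(x·y⁻¹) g(y) dy. -/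
def hConv (n : ℕ) (f g : Hn n → ℂ) (x : Hn n) : ℂ :=
  ∫ y : Hn n, f (x.1 - y.1, x.2 - y.2 - imZW x.1 y.1 / 2) * g y

/-- P is a bigraded solid harmonic of degree (p,q) on ℂⁿ: P(z) = ∑_{|α|=p,|β|=q} c_{αβ} z^α z̄^β,
harmonic as a function on ℝ^{2n} (the harmonicity Δ P = 0 is expressed by the equivalent
algebraic condition on the coefficients). -/
def IsBigradedSolidHarmonic (n p q : ℕ) (P : Cn n → ℂ) : Prop :=
  ∃ c : (Fin n → ℕ) → (Fin n → ℕ) → ℂ,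
    (∀ z : Cn n, P z =
      ∑ α ∈ Finset.Nat.antidiagonalTuple n p, ∑ β ∈ Finset.Nat.antidiagonalTuple n q,
        c α β * (∏ j, z j ^ α j) * ∏ j, (starRingEnd ℂ) (z j) ^ β j) ∧
    (∀ γ δ : Fin n → ℕ,
      ∑ j : Fin n, (((γ j + 1) * (δ j + 1) : ℕ) : ℂ) *
        c (Function.update γ j (γ j + 1)) (Function.update δ j (δ j + 1)) = 0)

/-- The physicists' Hermite polynomial H_m(x) = (−1)^m e^{x²} (d/dx)^m e^{−x²}. -/
def physHermite (m : ℕ) (x : ℝ) : ℝ :=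
  (-1 : ℝ) ^ m * Real.exp (x ^ 2) * iteratedDeriv m (fun y => Real.exp (-(y ^ 2))) x

/-- The normalized Hermite function h_m(x) = (2^m m! √π)^{−1/2} H_m(x) e^{−x²/2}. -/
def hermiteFun (m : ℕ) (x : ℝ) : ℝ :=
  (Real.sqrt (2 ^ m * (Nat.factorial m) * Real.sqrt π))⁻¹ * physHermite m x *
    Real.exp (-(x ^ 2) / 2)

/-- The scaled Hermite function Φ_α^λ(x) = |λ|^{n/4} ∏ⱼ h_{αⱼ}(√|λ| xⱼ). -/
def scaledHermite (n : ℕ) (lam : ℝ) (α : Fin n → ℕ) (x : Fin n → ℝ) : ℝ :=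
  |lam| ^ ((n : ℝ) / 4) * ∏ j, hermiteFun (α j) (Real.sqrt |lam| * x j)

/-- The Schrödinger representation: π_λ(z,t)φ(ξ) = e^{iλt} e^{iλ(x·ξ+(1/2)x·y)} φ(ξ+y),
z = x+iy. -/
def schrodinger (n : ℕ) (lam : ℝ) (zt : Hn n) (φ : (Fin n → ℝ) → ℂ) (ξ : Fin n → ℝ) : ℂ :=
  Complex.exp (Complex.I * (lam : ℂ) * (zt.2 : ℂ)) *
    Complex.exp (Complex.I * (lam : ℂ) *
      (((∑ j, (zt.1 j).re * ξ j) + (∑ j, (zt.1 j).re * (zt.1 j).im) / 2 : ℝ) : ℂ)) *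
    φ (fun j => ξ j + (zt.1 j).im)

/-- The group Fourier transform f̂(λ)φ = ∫ f(z,t) π_λ(z,t)φ dz dt. -/
def groupFT (n : ℕ) (f : Hn n → ℂ) (lam : ℝ) (φ : (Fin n → ℝ) → ℂ) (ξ : Fin n → ℝ) : ℂ :=
  ∫ x : Hn n, f x * schrodinger n lam x φ ξ

/-- A power series whose `m`-th coefficient is at most of order `B ^ m / m!`. -/
def HasExpDecay (p : PowerSeries ℝ) : Prop :=
  ∃ C B : ℝ, 0 ≤ C ∧ 1 ≤ B ∧ ∀ m, |PowerSeries.coeff m p| ≤ C * B ^ m / m.factorial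

theorem HasExpDecay.X_sub_C_mul {p : PowerSeries ℝ} (hp : HasExpDecay p) (a : ℝ) :
    HasExpDecay ((PowerSeries.X - PowerSeries.C a) * p) := by
  obtain ⟨C, B, hC, hB, h⟩ := hp
  refine ⟨C * (1 + |a|), 2 * B, by positivity, by linarith, fun m => ?_⟩
  have hB2 : B ^ m ≤ (2 * B) ^ m := by gcongr; linarith
  have ha : |a * PowerSeries.coeff m p| ≤ |a| * (C * (2 * B) ^ m / m.factorial) := by
    rw [abs_mul]
    gcongr
    refine (h m).trans ?_
    gcongr
  cases m with
  | zero =>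
    rw [sub_mul, map_sub, PowerSeries.coeff_C_mul, PowerSeries.coeff_zero_X_mul, zero_sub, abs_neg]
    refine ha.trans ?_
    simp only [pow_zero, Nat.factorial_zero, Nat.cast_one]
    linarith
  | succ m =>
    rw [sub_mul, map_sub, PowerSeries.coeff_C_mul, PowerSeries.coeff_succ_X_mul]
    refine (abs_sub _ _).trans ?_
    have hm : (m + 1 : ℝ) ≤ 2 ^ (m + 1) := by exact_mod_cast (Nat.lt_two_pow_self (n := m + 1)).le
    have h1 : C * B ^ m / m.factorial ≤ C * (2 * B) ^ (m + 1) / (m + 1).factorial := by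
      rw [Nat.factorial_succ, div_le_div_iff₀ (by positivity) (by positivity)]
      push_cast
      have : B ^ m * (m + 1) ≤ (2 * B) ^ (m + 1) := by
        rw [mul_pow, mul_comm]
        gcongr
        · omega
      calc C * B ^ m * ((m + 1) * m.factorial) = C * (B ^ m * (m + 1)) * m.factorial := by ring
        _ ≤ _ := by gcongr
    calc _ ≤ _ := add_le_add ((h m).trans h1) ha
      _ = _ := by ring

theorem HasExpDecay.summable_mul {p q : PowerSeries ℝ} (hp : HasExpDecay p) (hq : HasExpDecay q) :
    Summable fun m : ℕ => (m.factorial : ℝ) * (PowerSeries.coeff m p * PowerSeries.coeff m q) := by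
  obtain ⟨C, B, hC, hB, h⟩ := hp
  obtain ⟨C', B', hC', hB', h'⟩ := hq
  refine Summable.of_norm_bounded
    ((Real.summable_pow_div_factorial (B * B')).mul_left (C * C')) fun m => ?_
  rw [norm_mul, norm_mul, Real.norm_eq_abs, Real.norm_eq_abs, Real.norm_eq_abs, Nat.abs_cast]
  calc (m.factorial : ℝ) * (|PowerSeries.coeff m p| * |PowerSeries.coeff m q|)
      ≤ m.factorial * ((C * B ^ m / m.factorial) * (C' * B' ^ m / m.factorial)) := by
        gcongr
        · exact h m
        · exact h' m
    _ = _ := by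
        have : (m.factorial : ℝ) ≠ 0 := by positivity
        field_simp
        ring

/-- The Fock space pairing `∑ m! pₘ qₘ` of two power series. -/
def fockPairing (p q : PowerSeries ℝ) : ℝ :=
  ∑' m : ℕ, (m.factorial : ℝ) * (PowerSeries.coeff m p * PowerSeries.coeff m q)

/-- In Fock space, multiplication by `X - a` is adjoint to `d/dX - a`. -/
theorem fockPairing_X_sub_C_mul {p q r : PowerSeries ℝ} (hp : HasExpDecay p) (hq : HasExpDecay q)
    (hr : HasExpDecay r) (a : ℝ)
    (hqr : PowerSeries.derivative ℝ q = r + PowerSeries.C a * q) :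
    fockPairing ((PowerSeries.X - PowerSeries.C a) * p) q = fockPairing p r := by
  have hs1 := (hp.X_sub_C_mul a).summable_mul hq
  have hs2 := hp.summable_mul hq
  have hs3 := hp.summable_mul hr
  have hder : ∀ m, PowerSeries.coeff (m + 1) q * (m + 1) =
      PowerSeries.coeff m r + a * PowerSeries.coeff m q := fun m => by
    rw [← PowerSeries.coeff_derivative, hqr, map_add, PowerSeries.coeff_C_mul]
  have hs2' := (summable_nat_add_iff 1).2 hs2
  unfold fockPairing
  rw [hs1.tsum_eq_zero_add]
  have e1 : ∀ m : ℕ, ((m + 1).factorial : ℝ) *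
      (PowerSeries.coeff (m + 1) ((PowerSeries.X - PowerSeries.C a) * p) *
        PowerSeries.coeff (m + 1) q) =
      (m.factorial : ℝ) * (PowerSeries.coeff m p * PowerSeries.coeff m r) +
      a * ((m.factorial : ℝ) * (PowerSeries.coeff m p * PowerSeries.coeff m q)) -
      a * (((m + 1).factorial : ℝ) * (PowerSeries.coeff (m + 1) p *
        PowerSeries.coeff (m + 1) q)) := fun m => by
    rw [sub_mul, map_sub, PowerSeries.coeff_C_mul, PowerSeries.coeff_succ_X_mul,
      Nat.factorial_succ]
    push_cast
    linear_combination (m.factorial : ℝ) * PowerSeries.coeff m p * hder m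
  rw [tsum_congr e1, (hs3.add (hs2.mul_left a)).tsum_sub (hs2'.mul_left a),
    hs3.tsum_add (hs2.mul_left a), tsum_mul_left, tsum_mul_left, hs2.tsum_eq_zero_add,
    sub_mul, map_sub, PowerSeries.coeff_C_mul, PowerSeries.coeff_zero_X_mul]
  ring

/-- The power series `(X - a) ^ k * exp (a X)`. -/
def displacedMonomial (a : ℝ) (k : ℕ) : PowerSeries ℝ :=
  (PowerSeries.X - PowerSeries.C a) ^ k * PowerSeries.mk fun m => a ^ m / m.factorial

theorem displacedMonomial_succ (a : ℝ) (k : ℕ) : displacedMonomial a (k + 1) =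
    (PowerSeries.X - PowerSeries.C a) * displacedMonomial a k := by
  rw [displacedMonomial, displacedMonomial, pow_succ']
  ring

theorem hasExpDecay_displacedMonomial (a : ℝ) (k : ℕ) : HasExpDecay (displacedMonomial a k) := by
  induction k with
  | zero =>
    refine ⟨1, |a| + 1, by simp, by linarith [abs_nonneg a], fun m => ?_⟩
    rw [displacedMonomial, pow_zero, one_mul, PowerSeries.coeff_mk, abs_div, abs_pow, Nat.abs_cast,
      one_mul]
    gcongr
    linarith
  | succ k ih => exact displacedMonomial_succ a k ▸ ih.X_sub_C_mul a

theorem derivative_displacedMonomial_zero (a : ℝ) :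
    PowerSeries.derivative ℝ (displacedMonomial a 0) =
      PowerSeries.C a * displacedMonomial a 0 := by
  ext m
  rw [PowerSeries.coeff_derivative, PowerSeries.coeff_C_mul, displacedMonomial, pow_zero,
    one_mul, PowerSeries.coeff_mk, PowerSeries.coeff_mk, Nat.factorial_succ]
  push_cast
  field_simp
  ring

theorem derivative_displacedMonomial_succ (a : ℝ) (k : ℕ) :
    PowerSeries.derivative ℝ (displacedMonomial a (k + 1)) =
      PowerSeries.C (k + 1 : ℝ) * displacedMonomial a k +
        PowerSeries.C a * displacedMonomial a (k + 1) := by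
  have hX : PowerSeries.derivative ℝ (PowerSeries.X - PowerSeries.C a) = 1 := by
    ext m
    rw [PowerSeries.coeff_derivative]
    cases m <;> simp [PowerSeries.coeff_X, PowerSeries.coeff_one]
  induction k with
  | zero =>
    rw [displacedMonomial_succ, Derivation.leibniz, hX,
      derivative_displacedMonomial_zero]
    simp only [smul_eq_mul, mul_one, Nat.cast_zero, zero_add, map_one]
    ring
  | succ k ih =>
    rw [displacedMonomial_succ a (k + 1), Derivation.leibniz, hX, ih,
      displacedMonomial_succ a k]
    simp only [smul_eq_mul, mul_one, Nat.cast_add, Nat.cast_one, map_add, map_one]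
    ring

theorem HasExpDecay.C_mul {p : PowerSeries ℝ} (hp : HasExpDecay p) (c : ℝ) :
    HasExpDecay (PowerSeries.C c * p) := by
  obtain ⟨C, B, hC, hB, h⟩ := hp
  refine ⟨|c| * C, B, by positivity, hB, fun m => ?_⟩
  rw [PowerSeries.coeff_C_mul, abs_mul, mul_assoc, mul_div_assoc]
  gcongr
  exact h m

theorem fockPairing_C_mul_right (p q : PowerSeries ℝ) (c : ℝ) :
    fockPairing p (PowerSeries.C c * q) = c * fockPairing p q := by
  rw [fockPairing, fockPairing, ← tsum_mul_left]
  refine tsum_congr fun m => ?_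
  rw [PowerSeries.coeff_C_mul]
  ring

theorem fockPairing_displacedMonomial_self (a : ℝ) (k : ℕ) :
    fockPairing (displacedMonomial a k) (displacedMonomial a k) =
      k.factorial * Real.exp (a ^ 2) := by
  induction k with
  | zero =>
    rw [fockPairing, Real.exp_eq_exp_ℝ, NormedSpace.exp_eq_tsum_div, Nat.factorial_zero,
      Nat.cast_one, one_mul]
    refine tsum_congr fun m => ?_
    rw [displacedMonomial, pow_zero, one_mul, PowerSeries.coeff_mk, ← pow_mul, mul_comm 2 m,
      pow_mul]
    have : (m.factorial : ℝ) ≠ 0 := by positivity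
    field_simp
  | succ k ih =>
    have hk := hasExpDecay_displacedMonomial a k
    conv_lhs => arg 1; rw [displacedMonomial_succ a k]
    rw [fockPairing_X_sub_C_mul hk (hasExpDecay_displacedMonomial a (k + 1)) (hk.C_mul (k + 1)) a
      (derivative_displacedMonomial_succ a k), fockPairing_C_mul_right, ih, Nat.factorial_succ]
    push_cast
    ring

theorem coeff_displacedMonomial_self (a : ℝ) (k : ℕ) :
    PowerSeries.coeff k (displacedMonomial a k) = lagPoly 1 k (a ^ 2) := by
  have hX : (PowerSeries.X - PowerSeries.C a : PowerSeries ℝ) ^ k =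
      ((Polynomial.X + Polynomial.C (-a) : Polynomial ℝ) ^ k : Polynomial ℝ) := by
    simp [sub_eq_add_neg]
  rw [displacedMonomial, hX, PowerSeries.coeff_mul, Finset.Nat.sum_antidiagonal_eq_sum_range_succ_mk,
    lagPoly, ← Finset.sum_range_reflect]
  refine Finset.sum_congr rfl fun j hj => ?_
  have hj' : j ≤ k := by simpa [Nat.lt_succ_iff] using hj
  rw [Polynomial.coeff_coe, Polynomial.coeff_X_add_C_pow, PowerSeries.coeff_mk]
  have e1 : k + 1 - 1 - j = k - j := by omega
  have e2 : k - (k - j) = j := by omega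
  simp only [e1, e2, Nat.add_sub_cancel]
  rw [neg_pow a, neg_pow (a ^ 2), ← pow_mul, two_mul, pow_add, Nat.choose_symm hj']
  ring

theorem abs_lagPoly_one_le (k : ℕ) {t : ℝ} (ht : 0 ≤ t) :
    |lagPoly 1 k t| ≤ Real.exp (t / 2) := by
  have hsum := (hasExpDecay_displacedMonomial √t k).summable_mul (hasExpDecay_displacedMonomial √t k)
  have h := hsum.le_tsum k fun m _ =>
    mul_nonneg (Nat.cast_nonneg _) (mul_self_nonneg (PowerSeries.coeff m _))
  have h2 := fockPairing_displacedMonomial_self √t k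
  rw [fockPairing] at h2
  rw [h2, coeff_displacedMonomial_self, Real.sq_sqrt ht] at h
  have hk : (0 : ℝ) < k.factorial := by positivity
  have h3 := le_of_mul_le_mul_left h hk
  refine abs_le_of_sq_le_sq ?_ (Real.exp_pos _).le
  calc lagPoly 1 k t ^ 2 = lagPoly 1 k t * lagPoly 1 k t := sq _
    _ ≤ Real.exp t := h3
    _ = Real.exp (t / 2) ^ 2 := by rw [← Real.exp_nat_mul]; congr 1; push_cast; ring

theorem lagPoly_succ_succ (m k : ℕ) (t : ℝ) :
    lagPoly (m + 2) (k + 1) t = lagPoly (m + 2) k t + lagPoly (m + 1) (k + 1) t := by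
  have h : ∀ j ∈ Finset.range (k + 1),
      ((k + 1 + (m + 2) - 1).choose (k + 1 - j) : ℝ) * (-t) ^ j / j.factorial =
        ((k + (m + 2) - 1).choose (k - j) : ℝ) * (-t) ^ j / j.factorial +
          ((k + 1 + (m + 1) - 1).choose (k + 1 - j) : ℝ) * (-t) ^ j / j.factorial := fun j hj => by
    have hj' : j ≤ k := by simpa [Nat.lt_succ_iff] using hj
    rw [show k + 1 + (m + 2) - 1 = (k + m + 1) + 1 by omega, show k + 1 - j = (k - j) + 1 by omega,
      Nat.choose_succ_succ, show k + (m + 2) - 1 = k + m + 1 by omega,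
      show k + 1 + (m + 1) - 1 = k + m + 1 by omega]
    push_cast
    ring
  rw [lagPoly, lagPoly, lagPoly, Finset.sum_range_succ _ (k + 1), Finset.sum_congr rfl h,
    Finset.sum_add_distrib, Finset.sum_range_succ _ (k + 1)]
  simp only [Nat.sub_self, Nat.choose_zero_right, add_assoc]

theorem abs_lagPoly_succ_le (m k : ℕ) {t : ℝ} (ht : 0 ≤ t) :
    |lagPoly (m + 1) k t| ≤ (k + m).choose k * Real.exp (t / 2) := by
  induction m generalizing k with
  | zero => simpa using abs_lagPoly_one_le k ht
  | succ m ihm =>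
    induction k with
    | zero => simpa [lagPoly] using div_nonneg ht zero_le_two
    | succ k ihk =>
      rw [lagPoly_succ_succ, show k + 1 + (m + 1) = (k + (m + 1)) + 1 by omega,
        Nat.choose_succ_succ]
      refine (abs_add_le _ _).trans ?_
      push_cast
      rw [add_mul]
      refine add_le_add ihk ((ihm (k + 1)).trans_eq ?_)
      rw [show k + 1 + m = k + (m + 1) by omega]

theorem normC_mul_choose {n : ℕ} (hn : 1 ≤ n) {k j : ℕ} (hj : j ≤ k) :
    normC n k * (k + n - 1).choose (k - j) =
      (n - 1).factorial / (j + n - 1).factorial * k.descFactorial j := by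
  have h1 := Nat.choose_mul_factorial_mul_factorial (show k - j ≤ k + n - 1 by omega)
  have h2 := Nat.factorial_mul_descFactorial hj
  rw [show k + n - 1 - (k - j) = j + n - 1 by omega] at h1
  rw [normC, ← h1, ← h2]
  have : ((k + n - 1).choose (k - j) : ℝ) ≠ 0 := by
    exact_mod_cast (Nat.choose_pos (by omega)).ne'
  push_cast
  field_simp

theorem abs_normC_mul_lagFun_le {n : ℕ} (hn : 1 ≤ n) (k : ℕ) (lam : ℝ) (w : Cn n) :
    |normC n k * lagFun n k lam w| ≤ 1 := by
  obtain ⟨m, rfl⟩ : ∃ m, n = m + 1 := ⟨n - 1, by omega⟩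
  have h := abs_lagPoly_succ_le m k (t := |lam| * ‖w‖ ^ 2 / 2) (by positivity)
  have h0 := normC_mul_choose hn (Nat.zero_le k)
  have hm : (m.factorial : ℝ) ≠ 0 := by positivity
  simp [hm] at h0
  have hC : 0 ≤ normC (m + 1) k := by unfold normC; positivity
  rw [lagFun, abs_mul, abs_mul, abs_of_nonneg hC, Real.abs_exp]
  calc _ ≤ normC (m + 1) k * (((k + m).choose k * Real.exp (|lam| * ‖w‖ ^ 2 / 2 / 2)) *
        Real.exp (-(|lam| * ‖w‖ ^ 2 / 4))) := by gcongr
    _ = normC (m + 1) k * (k + m).choose k * (Real.exp (|lam| * ‖w‖ ^ 2 / 2 / 2) *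
        Real.exp (-(|lam| * ‖w‖ ^ 2 / 4))) := by ring
    _ = 1 := by
      rw [← Real.exp_add, h0, show |lam| * ‖w‖ ^ 2 / 2 / 2 + -(|lam| * ‖w‖ ^ 2 / 4) = 0 by ring]
      simp

theorem normC_mul_lagPoly {n : ℕ} (hn : 1 ≤ n) (k : ℕ) (t : ℝ) :
    normC n k * lagPoly n k t = ∑' i : ℕ, ((n - 1).factorial / (i + n - 1).factorial : ℝ) *
      k.descFactorial i * (-t) ^ i / i.factorial := by
  rw [lagPoly, Finset.mul_sum, tsum_eq_sum (s := Finset.range (k + 1))]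
  · refine Finset.sum_congr rfl fun i hi => ?_
    rw [← normC_mul_choose hn (by simpa [Nat.lt_succ_iff] using hi)]
    ring
  · intro i hi
    rw [Nat.descFactorial_eq_zero_iff_lt.2 (by simpa using hi)]
    simp

theorem tendsto_descFactorial_mul_pow {ι : Type*} {l : Filter ι} {k : ι → ℕ} {x : ι → ℝ} {c : ℝ}
    (hx : Tendsto x l (nhds 0)) (hk : Tendsto (fun j => (k j : ℝ) * x j) l (nhds c)) (i : ℕ) :
    Tendsto (fun j => ((k j).descFactorial i : ℝ) * x j ^ i) l (nhds (c ^ i)) := by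
  induction i with
  | zero => simpa using tendsto_const_nhds
  | succ i ih =>
    have h : Tendsto (fun j => ((k j - i : ℕ) : ℝ) * x j) l (nhds c) := by
      have h0 : Tendsto (fun j => ((k j - i : ℕ) : ℝ) * x j - k j * x j) l (nhds 0) := by
        refine squeeze_zero_norm (a := fun j => (i : ℝ) * ‖x j‖) (fun j => ?_) ?_
        · rw [← sub_mul, norm_mul, Real.norm_eq_abs ((k j - i : ℕ) - k j : ℝ)]
          gcongr
          have h1 : ((k j - i : ℕ) : ℝ) ≤ k j := by exact_mod_cast Nat.sub_le _ _
          have h2 : (k j : ℝ) ≤ (k j - i : ℕ) + i := by exact_mod_cast (by omega)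
          rw [abs_le]
          constructor <;> linarith [(Nat.cast_nonneg i : (0 : ℝ) ≤ i)]
        · simpa using hx.norm.const_mul (i : ℝ)
      simpa using h0.add hk
    rw [pow_succ']
    refine (h.mul ih).congr fun j => ?_
    rw [Nat.descFactorial_succ, pow_succ']
    push_cast
    ring

theorem tendsto_normC_mul_lagPoly {n : ℕ} (hn : 1 ≤ n) {k : ℕ → ℕ} {x : ℕ → ℝ} {c : ℝ}
    (hx : Tendsto x atTop (nhds 0)) (hk : Tendsto (fun j => (k j : ℝ) * x j) atTop (nhds c))
    (y : ℝ) :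
    Tendsto (fun j => normC n (k j) * lagPoly n (k j) (x j * y)) atTop
      (nhds (∑' i : ℕ, ((n - 1).factorial / (i + n - 1).factorial : ℝ) *
        (-(c * y)) ^ i / i.factorial)) := by
  simp_rw [normC_mul_lagPoly hn]
  obtain ⟨C, hC⟩ := hk.norm.isBoundedUnder_le.eventually_le
  refine tendsto_tsum_of_dominated_convergence (Real.summable_pow_div_factorial (C * |y|))
    (fun i => ?_) ?_
  · have h := (((tendsto_descFactorial_mul_pow hx hk i).const_mul
      ((n - 1).factorial / (i + n - 1).factorial : ℝ)).mul_const ((-y) ^ i)).div_const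
      (i.factorial : ℝ)
    rw [mul_assoc, ← mul_pow, mul_neg] at h
    refine h.congr fun j => ?_
    rw [neg_pow (x j * y), neg_pow y, mul_pow]
    ring
  · filter_upwards [hC] with j hj i
    rw [norm_div, norm_mul, norm_mul, norm_div]
    simp only [norm_pow, norm_neg, norm_mul, Real.norm_eq_abs, Nat.abs_cast] at hj ⊢
    gcongr ?_ / _
    have h1 : ((n - 1).factorial / (i + n - 1).factorial : ℝ) ≤ 1 := by
      rw [div_le_one (by positivity)]
      exact_mod_cast Nat.factorial_le (by omega)
    have h2 : ((k j).descFactorial i : ℝ) ≤ (k j : ℝ) ^ i := by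
      exact_mod_cast Nat.descFactorial_le_pow _ _
    calc _ ≤ 1 * (k j : ℝ) ^ i * (|x j| * |y|) ^ i := by gcongr
      _ = (k j * |x j| * |y|) ^ i := by ring
      _ ≤ _ := by
        gcongr

theorem tendsto_normC_mul_lagFun {n : ℕ} (hn : 1 ≤ n) {τ : ℝ} (hτ : 0 ≤ τ) {lam : ℕ → ℝ}
    (hlam0 : Tendsto lam atTop (nhds 0)) {k : ℕ → ℕ}
    (hk : Tendsto (fun j => (2 * (k j : ℝ) + n) * |lam j|) atTop (nhds τ)) (w : Cn n) :
    Tendsto (fun j => normC n (k j) * lagFun n (k j) (lam j) w) atTop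
      (nhds ((n - 1).factorial * 2 ^ (n - 1) * besselKer n (√τ * ‖w‖))) := by
  have hx : Tendsto (fun j => |lam j|) atTop (nhds 0) := by simpa using hlam0.abs
  have hk' : Tendsto (fun j => (k j : ℝ) * |lam j|) atTop (nhds (τ / 2)) := by
    have h := (hk.sub (hx.const_mul (n : ℝ))).div_const 2
    rw [mul_zero, sub_zero] at h
    exact h.congr fun j => by ring
  have hE : Tendsto (fun j => Real.exp (-(|lam j| * ‖w‖ ^ 2 / 4))) atTop (nhds 1) := by
    have h := (Real.continuous_exp.tendsto _).comp ((hx.mul_const (‖w‖ ^ 2)).div_const 4).neg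
    simpa [Function.comp_def] using h
  have h := (tendsto_normC_mul_lagPoly hn hx hk' (‖w‖ ^ 2 / 2)).mul hE
  have hB : ∑' i : ℕ, ((n - 1).factorial / (i + n - 1).factorial : ℝ) *
      (-(τ / 2 * (‖w‖ ^ 2 / 2))) ^ i / i.factorial =
      (n - 1).factorial * 2 ^ (n - 1) * besselKer n (√τ * ‖w‖) := by
    rw [besselKer, ← tsum_mul_left]
    refine tsum_congr fun i => ?_
    rw [pow_mul (√τ * ‖w‖), mul_pow √τ, Real.sq_sqrt hτ, Nat.add_sub_assoc hn (2 * i), pow_add,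
      pow_mul 2 2 i, neg_pow, show τ / 2 * (‖w‖ ^ 2 / 2) = τ * ‖w‖ ^ 2 / 2 ^ 2 by ring, div_pow]
    field_simp
  rw [mul_one, hB] at h
  refine h.congr fun j => ?_
  rw [lagFun, mul_div_assoc |lam j| _ 2, mul_assoc]

theorem continuous_lagFun (n k : ℕ) (lam : ℝ) : Continuous (lagFun n k lam) := by
  unfold lagFun lagPoly
  fun_prop

theorem continuous_imZW {n : ℕ} (z : Cn n) : Continuous fun w : Cn n => imZW z w := by
  unfold imZW
  fun_prop

theorem norm_exp_I_mul_mul (x y : ℝ) : ‖Complex.exp (Complex.I * x * y)‖ = 1 := by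
  rw [mul_assoc, ← Complex.ofReal_mul, mul_comm, Complex.norm_exp_ofReal_mul_I]

theorem norm_fLam_le (n : ℕ) (f : Hn n → ℂ) (lam : ℝ) (z : Cn n) :
    ‖fLam n f lam z‖ ≤ ∫ t : ℝ, ‖f (z, t)‖ := by
  refine (norm_integral_le_integral_norm _).trans_eq ?_
  simp only [norm_mul, norm_exp_I_mul_mul, one_mul]

theorem aestronglyMeasurable_fLam {n : ℕ} {f : Hn n → ℂ} (hf : Integrable f) (lam : ℝ) :
    AEStronglyMeasurable (fLam n f lam) := by
  have h : AEStronglyMeasurable (fun x : Hn n => Complex.exp (Complex.I * lam * x.2) * f x)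
      ((volume : Measure (Cn n)).prod (volume : Measure ℝ)) :=
    AEStronglyMeasurable.mul (by fun_prop) hf.aestronglyMeasurable
  exact h.integral_prod_right'

theorem continuous_fLam {n : ℕ} {f : Hn n → ℂ} {z : Cn n}
    (hf : Integrable fun t : ℝ => f (z, t)) : Continuous fun lam => fLam n f lam z := by
  refine continuous_of_dominated (bound := fun t => ‖f (z, t)‖) (fun lam => ?_) (fun lam => ?_)
    hf.norm ?_
  · exact AEStronglyMeasurable.mul (by fun_prop) hf.aestronglyMeasurable
  · exact .of_forall fun t => by rw [norm_mul, norm_exp_I_mul_mul, one_mul]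
  · exact .of_forall fun t => by fun_prop

/-- If λ_j → 0 with λ_j ≠ 0 and (2k_j+n)|λ_j| → τ, then the normalized Strichartz Fourier
transform along the rays converges to its value on the limiting ray. -/
theorem strichartz_tendsto_limiting_ray (n : ℕ) (hn : 1 ≤ n)
    (f : Hn n → ℂ) (hf : Integrable f (volume : Measure (Hn n))) (z : Cn n)
    (τ : ℝ) (hτ : 0 ≤ τ) (lam : ℕ → ℝ) (hlam : ∀ j, lam j ≠ 0)
    (hlam0 : Tendsto lam atTop (nhds 0)) (k : ℕ → ℕ)
    (hk : Tendsto (fun j => (2 * (k j : ℝ) + n) * |lam j|) atTop (nhds τ)) :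
    Tendsto (fun j => ((normC n (k j) : ℝ) : ℂ) * stri n f (k j) (lam j) z) atTop
      (nhds (striLim n f z τ)) := by
  have hmp : MeasurePreserving (fun w : Cn n => z - w) :=
    Measure.measurePreserving_sub_left volume z
  have hf' : Integrable f ((volume : Measure (Cn n)).prod (volume : Measure ℝ)) := hf
  have hval : striLim n f z τ = ∫ w : Cn n, fLam n f 0 (z - w) *
      (((n - 1).factorial * 2 ^ (n - 1) * besselKer n (√τ * ‖w‖) : ℝ) : ℂ) := by
    rw [striLim, ← integral_const_mul]
    refine integral_congr_ae (.of_forall fun w => ?_)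
    push_cast
    ring
  rw [hval]
  simp_rw [stri, twConv, ← integral_const_mul]
  refine tendsto_integral_of_dominated_convergence (fun w => ∫ t : ℝ, ‖f (z - w, t)‖)
    (fun j => ?_) ?_ (fun j => .of_forall fun w => ?_) ?_
  · have h1 : AEStronglyMeasurable fun w : Cn n => fLam n f (-lam j) (z - w) :=
      (aestronglyMeasurable_fLam hf _).comp_measurePreserving hmp
    have h2 := continuous_lagFun n (k j) (lam j)
    have h3 := continuous_imZW z
    exact ((h1.mul (by fun_prop)).mul (by fun_prop)).const_mul _
  · exact hmp.integrable_comp_of_integrable hf'.integral_norm_prod_left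
  · have hI : ∀ x y : ℝ, ‖Complex.exp (Complex.I / 2 * x * y)‖ = 1 := fun x y => by
      rw [show Complex.I / 2 * x * y = Complex.I * x * (y / 2 : ℝ) by push_cast; ring,
        norm_exp_I_mul_mul]
    have hL := abs_normC_mul_lagFun_le hn (k j) (lam j) w
    calc _ = ‖fLam n f (-lam j) (z - w)‖ * |normC n (k j) * lagFun n (k j) (lam j) w| := by
          rw [norm_mul, norm_mul, norm_mul, hI, Complex.norm_real, Complex.norm_real,
            abs_mul, Real.norm_eq_abs, Real.norm_eq_abs]
          ring
      _ ≤ (∫ t : ℝ, ‖f (z - w, t)‖) * 1 := by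
          gcongr
          exact norm_fLam_le n f _ _
      _ = _ := mul_one _
  · filter_upwards [hmp.quasiMeasurePreserving.ae hf'.prod_right_ae] with w hw
    have hneg : Tendsto (fun j => -lam j) atTop (nhds 0) := by simpa using hlam0.neg
    have h1 := ((continuous_fLam hw).tendsto 0).comp hneg
    have h2 := (Complex.continuous_ofReal.tendsto _).comp (tendsto_normC_mul_lagFun hn hτ hlam0 hk w)
    have h3 : Tendsto (fun j => Complex.exp (Complex.I / 2 * ((-lam j : ℝ) : ℂ) *
        ((imZW z w : ℝ) : ℂ))) atTop (nhds 1) := by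
      have hc : Continuous fun x : ℝ => Complex.exp (Complex.I / 2 * (x : ℂ) *
        ((imZW z w : ℝ) : ℂ)) := by fun_prop
      simpa [Function.comp_def] using (hc.tendsto 0).comp hneg
    have h := (h1.mul h2).mul h3
    rw [mul_one] at h
    refine h.congr fun j => ?_
    simp only [Function.comp_apply]
    push_cast
    ring
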